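/- For any language L over a priority alphabet, the block downward closure L⇓ = { u | ∃ v ∈ L, u ⊴ v } is a regular language. -/

import Mathlib

/-- Glue together a decomposition into blocks and separator letters:
`glue [(u₀,x₀),…,(u_{n-1},x_{n-1})] u_n = u₀x₀u₁x₁⋯x_{n-1}u_n`. -/
def glue {α : Type*} (ps : List (List α × α)) (last : List α) : List α :=
  (ps.map (fun p => p.1 ++ [p.2])).flatten ++ last

/-- The `i`-th block of a decomposition (`last` for the final index). -/
def blockAt {α : Type*} (ps : List (List α × α)) (last : List α) (i : ℕ) :
    List α :=
  if h : i < ps.length then (ps.get ⟨i, h⟩).1 else last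

/-- The blockSegment `v_i y_i v_{i+1} ⋯ y_{j-1} v_j` of a decomposition. -/
def blockSegment {α : Type*} (ps : List (List α × α)) (last : List α) (i j : ℕ) :
    List α :=
  glue ((ps.take j).drop i) (blockAt ps last j)

/-- The block order at priority level `p`: at level `0` (a single priority) it
is the subword order; at level `p+1`, either both words consist solely of
letters of priority `p+1` and are related by the subword order, or both words
are split at their priority-`p+1` letters into sub-blocks of lower priority and
there is a strictly increasing witness block map `φ` sending the first block to
the first and the last block to the last, such that blocks embed recursively in
the block order and each separator letter embeds as a subword into the
corresponding blockSegment of the larger word. -/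
def BlockLE {α : Type*} (prio : α → ℕ) : ℕ → List α → List α → Prop
  | 0, u, v => u.Sublist v
  | (p+1), u, v =>
      ((∀ a ∈ u, prio a = p + 1) ∧ (∀ a ∈ v, prio a = p + 1) ∧ u.Sublist v) ∨
      ∃ (us : List (List α × α)) (ulast : List α)
        (vs : List (List α × α)) (vlast : List α) (φ : ℕ → ℕ),
        u = glue us ulast ∧ v = glue vs vlast ∧
        (∀ q ∈ us, prio q.2 = p + 1 ∧ ∀ a ∈ q.1, prio a ≤ p) ∧
        (∀ a ∈ ulast, prio a ≤ p) ∧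
        (∀ q ∈ vs, prio q.2 = p + 1 ∧ ∀ a ∈ q.1, prio a ≤ p) ∧
        (∀ a ∈ vlast, prio a ≤ p) ∧
        (∀ i j, i < j → j ≤ us.length → φ i < φ j) ∧
        φ 0 = 0 ∧ φ us.length = vs.length ∧
        (∀ i ≤ us.length,
          BlockLE prio p (blockAt us ulast i) (blockAt vs vlast (φ i))) ∧
        (∀ i (h : i < us.length),
          [(us.get ⟨i, h⟩).2].Sublist (blockSegment vs vlast (φ i) (φ (i + 1))))

section Glue

variable {α : Type*}

@[simp]
theorem glue_nil (last : List α) : glue [] last = last := rfl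

@[simp]
theorem glue_cons (b : List α) (x : α) (ps : List (List α × α)) (last : List α) :
    glue ((b, x) :: ps) last = b ++ x :: glue ps last := by
  simp [glue]

theorem mem_glue {ps : List (List α × α)} {last : List α} {a : α} :
    a ∈ glue ps last ↔ (∃ q ∈ ps, a ∈ q.1 ∨ a = q.2) ∨ a ∈ last := by
  induction ps with
  | nil => simp
  | cons q ps ih =>
    obtain ⟨b, x⟩ := q
    simp [ih, or_assoc]

/-- The decomposition `(ps, last)` splits a word at its letters of priority `p`, and all its
other letters have lower priority. -/
def IsDecomp (prio : α → ℕ) (p : ℕ) (ps : List (List α × α)) (last : List α) : Prop :=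
  (∀ q ∈ ps, prio q.2 = p ∧ ∀ a ∈ q.1, prio a < p) ∧ ∀ a ∈ last, prio a < p

variable {prio : α → ℕ} {p : ℕ}

theorem isDecomp_cons {b : List α} {x : α} {ps : List (List α × α)} {last : List α} :
    IsDecomp prio p ((b, x) :: ps) last ↔
      prio x = p ∧ (∀ a ∈ b, prio a < p) ∧ IsDecomp prio p ps last := by
  simp [IsDecomp, and_assoc]

theorem exists_isDecomp (w : List α) (hw : ∀ a ∈ w, prio a < p + 1) :
    ∃ ps last, IsDecomp prio p ps last ∧ w = glue ps last := by
  induction w with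
  | nil => exact ⟨[], [], by simp [IsDecomp], rfl⟩
  | cons a w ih =>
    obtain ⟨ps, last, h, rfl⟩ := ih fun c hc => hw c (by simp [hc])
    have ha := hw a (by simp)
    rcases Nat.lt_succ_iff_lt_or_eq.1 ha with ha | ha
    · cases ps with
      | nil => exact ⟨[], a :: last, by simpa [IsDecomp, ha] using h, rfl⟩
      | cons q ps =>
        obtain ⟨b, x⟩ := q
        rw [isDecomp_cons] at h
        exact ⟨(a :: b, x) :: ps, last, by simpa [isDecomp_cons, ha] using h, by simp⟩
    · exact ⟨([], a) :: ps, last, by simpa [isDecomp_cons, ha] using h, by simp⟩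

theorem IsDecomp.split_separator {ps : List (List α × α)} {last s r : List α} {y : α}
    (h : IsDecomp prio p ps last) (hy : prio y = p) (e : glue ps last = s ++ y :: r) :
    ∃ ss b ts, ps = ss ++ (b, y) :: ts ∧ s = glue ss b ∧ r = glue ts last := by
  induction ps generalizing s with
  | nil =>
    have := h.2 y (by rw [glue_nil] at e; simp [e])
    omega
  | cons q ps ih =>
    obtain ⟨b, x⟩ := q
    rw [isDecomp_cons] at h
    rw [glue_cons, List.append_eq_append_iff] at e
    rcases e with ⟨c, rfl, e⟩ | ⟨c, rfl, e⟩
    · cases c with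
      | nil =>
        simp only [List.nil_append, List.cons.injEq] at e
        obtain ⟨rfl, rfl⟩ := e
        exact ⟨[], b, ps, by simp⟩
      | cons z c =>
        simp only [List.cons_append, List.cons.injEq] at e
        obtain ⟨rfl, e⟩ := e
        obtain ⟨ss, b', ts, rfl, rfl, rfl⟩ := ih h.2.2 e
        exact ⟨(b, x) :: ss, b', ts, by simp⟩
    · cases c with
      | nil =>
        simp only [List.nil_append, List.cons.injEq] at e
        obtain ⟨rfl, rfl⟩ := e
        exact ⟨[], s, ps, by simp⟩
      | cons z c =>
        simp only [List.cons_append, List.cons.injEq] at e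
        obtain ⟨rfl, e⟩ := e
        have := h.2.1 y (by simp)
        omega

theorem IsDecomp.split_low {ps : List (List α × α)} {last s m t : List α}
    (h : IsDecomp prio p ps last) (hm : ∀ a ∈ m, prio a < p) (hm' : m ≠ [])
    (e : glue ps last = s ++ (m ++ t)) :
    (∃ s', last = s' ++ (m ++ t) ∧ s = glue ps s') ∨
      ∃ ss s' t' x ts, ps = ss ++ (s' ++ (m ++ t'), x) :: ts ∧ s = glue ss s' ∧
        t = t' ++ x :: glue ts last := by
  induction ps generalizing s with
  | nil => exact .inl ⟨s, e, rfl⟩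
  | cons q ps ih =>
    obtain ⟨b, x⟩ := q
    rw [isDecomp_cons] at h
    have hx : x ∉ m := fun hx => by
      have := hm x hx
      omega
    rw [glue_cons, List.append_eq_append_iff] at e
    rcases e with ⟨c, rfl, e⟩ | ⟨c, rfl, e⟩
    · cases c with
      | nil =>
        cases m with
        | nil => exact absurd rfl hm'
        | cons z m =>
          simp only [List.nil_append, List.cons_append, List.cons.injEq] at e
          exact absurd (by simp [e.1]) hx
      | cons z c =>
        simp only [List.cons_append, List.cons.injEq] at e
        obtain ⟨rfl, e⟩ := e
        rcases ih h.2.2 e with ⟨s', rfl, rfl⟩ | ⟨ss, s', t', x', ts, rfl, rfl, rfl⟩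
        · exact .inl ⟨s', rfl, by simp⟩
        · exact .inr ⟨(b, x) :: ss, s', t', x', ts, by simp⟩
    · right
      rw [List.append_eq_append_iff] at e
      rcases e with ⟨c', rfl, e⟩ | ⟨c', rfl, e⟩
      · exact ⟨[], s, c', x, ps, by simp, rfl, by simp [e]⟩
      · cases c' with
        | nil =>
          simp only [List.nil_append] at e
          exact ⟨[], s, [], x, ps, by simp, rfl, by simp [← e]⟩
        | cons z c' =>
          simp only [List.cons_append, List.cons.injEq] at e
          exact absurd (by simp [e.1]) hx

theorem glue_append_cons (ss : List (List α × α)) (b : List α) (x : α)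
    (ts : List (List α × α)) (last : List α) :
    glue (ss ++ (b, x) :: ts) last = glue ss b ++ x :: glue ts last := by
  simp [glue]

theorem glue_append_last (ps : List (List α × α)) (b c : List α) :
    glue ps (b ++ c) = glue ps b ++ c := by
  simp [glue]

theorem IsDecomp.blockAt_lt {ps : List (List α × α)} {last : List α}
    (h : IsDecomp prio p ps last) (i : ℕ) : ∀ a ∈ blockAt ps last i, prio a < p := by
  unfold blockAt
  split
  · exact (h.1 _ (List.get_mem _ _)).2
  · exact h.2

theorem IsDecomp.mem_blockSegment_mono {ps : List (List α × α)} {last : List α}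
    (h : IsDecomp prio p ps last) {x : α} (hx : prio x = p) {i j k : ℕ} (hjk : j ≤ k)
    (hm : x ∈ blockSegment ps last i j) : x ∈ blockSegment ps last i k := by
  have hsub : (ps.take j).drop i ⊆ (ps.take k).drop i := by
    intro q hq
    simp only [List.drop_take] at hq ⊢
    exact ((List.take_prefix_take_left (by omega)).sublist.subset) hq
  rw [blockSegment, mem_glue] at hm ⊢
  rcases hm with ⟨q, hq, hxq⟩ | hm
  · exact .inl ⟨q, hsub hq, hxq⟩
  · have := h.blockAt_lt j x hm
    omega

end Glue

section Reduction

variable {α : Type*}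

/-- The monotone preorder generated by shortening a factor `y w z`, where `y` and `z` have the
same priority and `w` has only letters of lower priority, to `y`. -/
inductive Reduces (prio : α → ℕ) : List α → List α → Prop
  | refl (u) : Reduces prio u u
  | trans {u v w} : Reduces prio u v → Reduces prio v w → Reduces prio u w
  | append {u u' v v'} : Reduces prio u u' → Reduces prio v v' →
      Reduces prio (u ++ v) (u' ++ v')
  | contract {y z : α} {w : List α} : prio z = prio y → (∀ a ∈ w, prio a < prio y) →
      Reduces prio [y] (y :: (w ++ [z]))

instance (prio : α → ℕ) : IsPreorder (List α) (Reduces prio) where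
  refl := .refl
  trans _ _ _ := .trans

variable {prio : α → ℕ} {p : ℕ}

theorem Reduces.skip {x y : α} {w r : List α} (hxy : prio y = prio x)
    (hw : ∀ a ∈ w, prio a < prio x) : Reduces prio (x :: r) (x :: (w ++ y :: r)) := by
  simpa using (Reduces.contract hxy hw).append (.refl r)

/-- The product of `Reduces` on blocks and equality on separators. -/
def BlockReduces (prio : α → ℕ) (q q' : List α × α) : Prop :=
  Reduces prio q.1 q'.1 ∧ q.2 = q'.2

instance (prio : α → ℕ) : IsPreorder (List α × α) (BlockReduces prio) where
  refl _ := ⟨.refl _, rfl⟩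
  trans _ _ _ h h' := ⟨h.1.trans h'.1, h.2.trans h'.2⟩

theorem Reduces.cons_glue {ps qs : List (List α × α)} {l m : List α}
    (h : List.SublistForall₂ (BlockReduces prio) ps qs) (hlm : Reduces prio l m)
    (hqs : ∀ q ∈ qs, prio q.2 = p ∧ ∀ a ∈ q.1, prio a < p) {x : α} (hx : prio x = p) :
    Reduces prio (x :: glue ps l) (x :: glue qs m) := by
  induction h generalizing x with
  | @nil qs =>
    induction qs with
    | nil => exact (Reduces.refl [x]).append hlm
    | cons q qs ih =>
      obtain ⟨b, y⟩ := q
      have hq := hqs (b, y) (by simp)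
      rw [glue_cons]
      refine (ih fun q hq => hqs q (by simp [hq])).trans (.skip ?_ ?_)
      · rw [hx, hq.1]
      · rw [hx]
        exact hq.2
  | @cons q q' ps qs hq _ ih =>
    obtain ⟨b, y⟩ := q
    obtain ⟨b', y'⟩ := q'
    obtain ⟨hb, hy⟩ := hq
    dsimp only at hb hy
    subst hy
    simp only [glue_cons]
    exact (Reduces.refl [x]).append (hb.append
      (ih (fun q hq => hqs q (by simp [hq])) (hqs (b', y) (by simp)).1))
  | @cons_right q ps qs _ ih =>
    obtain ⟨b, y⟩ := q
    have hq := hqs (b, y) (by simp)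
    rw [glue_cons]
    refine (ih (fun q hq => hqs q (by simp [hq])) hx).trans (.skip ?_ ?_)
    · rw [hx, hq.1]
    · rw [hx]
      exact hq.2

theorem partiallyWellOrderedOn_reduces [Finite α] (prio : α → ℕ) (p : ℕ) :
    {w : List α | ∀ a ∈ w, prio a < p}.PartiallyWellOrderedOn (Reduces prio) := by
  induction p with
  | zero =>
    refine (Set.partiallyWellOrderedOn_singleton []).mono fun w hw => ?_
    exact List.eq_nil_iff_forall_not_mem.2 fun a ha => absurd (hw a ha) (Nat.not_lt_zero _)
  | succ p ih =>
    have hblock := (ih.prod ((Set.toFinite {x : α | prio x = p}).partiallyWellOrderedOn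
      (r := Eq)))
    have hlist := Set.PartiallyWellOrderedOn.partiallyWellOrderedOn_sublistForall₂
      (BlockReduces prio) hblock
    have : IsPreorder ((List α × α) × List (List α × α)) fun x y =>
        BlockReduces prio x.1 y.1 ∧ List.SublistForall₂ (BlockReduces prio) x.2 y.2 :=
      { refl := fun x => ⟨refl _, refl _⟩
        trans := fun x y z h h' => ⟨_root_.trans h.1 h'.1, _root_.trans h.2 h'.2⟩ }
    have hall := (Set.PartiallyWellOrderedOn.prod (r := BlockReduces prio) hblock hlist).prod ih
    refine (ih.union (hall.image_of_monotone_on (r' := Reduces prio)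
      (f := fun x => glue (x.1.1 :: x.1.2) x.2) ?_)).mono ?_
    · rintro ⟨⟨⟨b, x⟩, ps⟩, l⟩ h ⟨⟨⟨b', x'⟩, ps'⟩, l'⟩ h' ⟨⟨⟨hb, hx⟩, hps⟩, hl⟩
      dsimp only at hb hx hps hl
      subst hx
      simp only [glue_cons]
      exact hb.append (.cons_glue hps hl (fun q hq => (h'.1.2 q hq).symm) h.1.1.2)
    · intro w hw
      obtain ⟨ps, l, h, rfl⟩ := exists_isDecomp w hw
      cases ps with
      | nil => exact .inl h.2
      | cons q ps =>
        refine .inr ⟨((q, ps), l), ⟨⟨?_, ?_⟩, h.2⟩, rfl⟩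
        · exact (h.1 q (by simp)).symm
        · exact fun q hq => (h.1 q (by simp [hq])).symm

end Reduction

/-- A language that is downward closed under a well-quasi-order compatible with concatenation
is regular. -/
theorem Language.isRegular_of_wellQuasiOrdered {α : Type*} {r : List α → List α → Prop}
    [IsPreorder (List α) r] (hr : WellQuasiOrdered r)
    (happ : ∀ u u' v v', r u u' → r v v' → r (u ++ v) (u' ++ v')) (K : Language α)
    (hK : ∀ u v, r u v → v ∈ K → u ∈ K) : K.IsRegular := by
  rw [Language.isRegular_iff_finite_range_leftQuotient]
  by_contra hinf
  have hinf : (Set.range K.leftQuotient).Infinite := hinf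
  choose x hx using fun n => (hinf.natEmbedding _ n).2
  obtain ⟨g, hg⟩ := hr.exists_monotone_subseq x
  have hanti : ∀ m n, m ≤ n → ∀ y, y ∈ K.leftQuotient (x (g n)) → y ∈ K.leftQuotient (x (g m)) :=
    fun m n h y hy => hK _ _ (happ _ _ _ _ (hg m n h) (refl y)) hy
  have hex : ∀ n, ∃ y, y ∈ K.leftQuotient (x (g n)) ∧ y ∉ K.leftQuotient (x (g (n + 1))) := by
    intro n
    by_contra! hc
    have heq : K.leftQuotient (x (g n)) = K.leftQuotient (x (g (n + 1))) :=
      Set.Subset.antisymm hc (hanti n (n + 1) (by omega))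
    rw [hx, hx] at heq
    have := g.injective ((hinf.natEmbedding _).injective (Subtype.ext heq))
    omega
  choose y hy hy' using hex
  obtain ⟨m, n, hmn, h⟩ := hr y
  exact hy' m (hK _ _ (happ _ _ _ _ (refl _) h) (hanti (m + 1) n hmn _ (hy n)))

section BlockOrder

variable {α : Type*} {prio : α → ℕ} {p : ℕ}

/-- There is a witness block map between two decompositions at priority `p + 1`. -/
def BlockEmb (prio : α → ℕ) (p : ℕ) (us : List (List α × α)) (ulast : List α)
    (vs : List (List α × α)) (vlast : List α) : Prop :=
  ∃ φ : ℕ → ℕ,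
    (∀ i j, i < j → j ≤ us.length → φ i < φ j) ∧
    φ 0 = 0 ∧ φ us.length = vs.length ∧
    (∀ i ≤ us.length,
      BlockLE prio p (blockAt us ulast i) (blockAt vs vlast (φ i))) ∧
    (∀ i (h : i < us.length),
      [(us.get ⟨i, h⟩).2].Sublist (blockSegment vs vlast (φ i) (φ (i + 1))))

theorem blockLE_succ_iff {u v : List α} :
    BlockLE prio (p + 1) u v ↔
      ((∀ a ∈ u, prio a = p + 1) ∧ (∀ a ∈ v, prio a = p + 1) ∧ u.Sublist v) ∨
      ∃ us ulast vs vlast, u = glue us ulast ∧ v = glue vs vlast ∧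
        IsDecomp prio (p + 1) us ulast ∧ IsDecomp prio (p + 1) vs vlast ∧
        BlockEmb prio p us ulast vs vlast := by
  simp only [BlockLE, IsDecomp, BlockEmb, Nat.lt_succ_iff]
  refine or_congr Iff.rfl ⟨?_, ?_⟩
  · rintro ⟨us, ul, vs, vl, φ, h1, h2, h3, h4, h5, h6, h⟩
    exact ⟨us, ul, vs, vl, h1, h2, ⟨h3, h4⟩, ⟨h5, h6⟩, φ, h⟩
  · rintro ⟨us, ul, vs, vl, h1, h2, ⟨h3, h4⟩, ⟨h5, h6⟩, φ, h⟩
    exact ⟨us, ul, vs, vl, φ, h1, h2, h3, h4, h5, h6, h⟩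

theorem BlockEmb.congr_blocks {us us' vs : List (List α × α)} {ul ul' vl : List α}
    (h : BlockEmb prio p us ul vs vl) (hsep : us'.map Prod.snd = us.map Prod.snd)
    (hb : ∀ i ≤ us.length, ∀ z,
      BlockLE prio p (blockAt us ul i) z → BlockLE prio p (blockAt us' ul' i) z) :
    BlockEmb prio p us' ul' vs vl := by
  obtain ⟨φ, h1, h2, h3, h4, h5⟩ := h
  have hlen : us'.length = us.length := by simpa using congrArg List.length hsep
  refine ⟨φ, ?_, h2, ?_, ?_, ?_⟩
  · rwa [hlen]
  · rwa [hlen]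
  · rw [hlen]
    exact fun i hi => hb i hi _ (h4 i hi)
  · intro i hi
    have hget : (us'.get ⟨i, hi⟩).2 = (us.get ⟨i, hlen ▸ hi⟩).2 := by
      have := List.getElem_of_eq hsep (i := i) (by simpa using hi)
      simpa using this
    rw [hget]
    exact h5 i _

theorem BlockEmb.replace_last {us vs : List (List α × α)} {b b' vl : List α}
    (h : BlockEmb prio p us b vs vl) (hb : ∀ z, BlockLE prio p b z → BlockLE prio p b' z) :
    BlockEmb prio p us b' vs vl := by
  refine h.congr_blocks rfl fun i hi z => ?_
  unfold blockAt
  split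
  · exact id
  · exact hb z

theorem BlockEmb.replace_block {ss ts vs : List (List α × α)} {b b' ul vl : List α} {x : α}
    (h : BlockEmb prio p (ss ++ (b, x) :: ts) ul vs vl)
    (hb : ∀ z, BlockLE prio p b z → BlockLE prio p b' z) :
    BlockEmb prio p (ss ++ (b', x) :: ts) ul vs vl := by
  refine h.congr_blocks (by simp) fun i hi z => ?_
  rcases lt_trichotomy i ss.length with hi' | rfl | hi'
  · simp [blockAt, hi', Nat.lt_add_right]
  · simpa [blockAt] using hb z
  · obtain ⟨k, rfl⟩ := Nat.exists_eq_add_of_lt hi'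
    simp [blockAt, add_assoc]

theorem BlockEmb.contract {ss ts vs : List (List α × α)} {b w ul vl : List α} {y y' : α}
    (hy : prio y = p + 1) (hv : IsDecomp prio (p + 1) vs vl)
    (h : BlockEmb prio p (ss ++ (b, y) :: (w, y') :: ts) ul vs vl) :
    BlockEmb prio p (ss ++ (b, y) :: ts) ul vs vl := by
  obtain ⟨φ, h1, h2, h3, h4, h5⟩ := h
  simp only [List.length_append, List.length_cons] at h1 h3 h4 h5
  refine ⟨fun i => if i ≤ ss.length then φ i else φ (i + 1), ?_, ?_, ?_, ?_, ?_⟩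
  · intro i j hij hj
    simp only [List.length_append, List.length_cons] at hj
    dsimp only
    split_ifs <;> first | omega | exact h1 _ _ (by omega) (by omega)
  · simpa using h2
  · simpa [add_assoc] using h3
  · intro i hi
    simp only [List.length_append, List.length_cons] at hi
    rcases lt_trichotomy i ss.length with hi' | rfl | hi'
    · have := h4 i (by omega)
      simpa [blockAt, hi', hi'.le, Nat.lt_add_right] using this
    · have := h4 ss.length (by omega)
      simpa [blockAt] using this
    · obtain ⟨k, rfl⟩ := Nat.exists_eq_add_of_lt hi'
      have := h4 (ss.length + k + 1 + 1) (by omega)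
      simpa [blockAt, add_assoc] using this
  · intro i hi
    simp only [List.length_append, List.length_cons] at hi
    rcases lt_trichotomy i ss.length with hi' | rfl | hi'
    · have := h5 i (by omega)
      simpa [hi', hi'.le, Nat.succ_le_of_lt hi'] using this
    · have := h5 ss.length (by omega)
      simp only [List.singleton_sublist] at this ⊢
      simp only [le_refl, if_true, List.get_eq_getElem, List.getElem_append_right,
        Nat.sub_self, List.getElem_cons_zero] at this ⊢
      rw [if_neg (by omega)]
      exact hv.mem_blockSegment_mono hy (h1 _ _ (by omega) (by omega)).le this
    · obtain ⟨k, rfl⟩ := Nat.exists_eq_add_of_lt hi'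
      have := h5 (ss.length + k + 1 + 1) (by omega)
      simpa [add_assoc] using this

theorem BlockLE.contract {s t w z : List α} {y y' : α} (hyy' : prio y' = prio y)
    (hw : ∀ a ∈ w, prio a < prio y) (hlt : prio y ≤ p)
    (h : BlockLE prio p (s ++ (y :: (w ++ [y']) ++ t)) z) :
    BlockLE prio p (s ++ ([y] ++ t)) z := by
  have hsub : ∀ s t : List α, (s ++ ([y] ++ t)).Sublist (s ++ (y :: (w ++ [y']) ++ t)) :=
    fun s t => (List.Sublist.refl s).append (.append (by simp) (.refl t))
  induction p generalizing s t z with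
  | zero => exact (hsub s t).trans h
  | succ p ih =>
    rw [blockLE_succ_iff] at h ⊢
    rcases h with ⟨h1, h2, h3⟩ | ⟨us, ul, vs, vl, e, rfl, hu, hv, h⟩
    · exact .inl ⟨fun a ha => h1 a ((hsub s t).subset ha), h2, (hsub s t).trans h3⟩
    right
    rcases Nat.lt_or_eq_of_le hlt with hlow | hy
    · have hm : ∀ a ∈ y :: (w ++ [y']), prio a < p + 1 := by
        intro a ha
        simp only [List.mem_cons, List.mem_append, List.not_mem_nil, or_false] at ha
        rcases ha with rfl | ha | rfl
        · exact hlow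
        · exact (hw a ha).trans hlow
        · exact hyy' ▸ hlow
      rcases hu.split_low hm (by simp) e.symm with
        ⟨s', rfl, rfl⟩ | ⟨ss, s', t', x, ts, rfl, rfl, rfl⟩
      · refine ⟨us, s' ++ ([y] ++ t), vs, vl, by simp [glue_append_last], rfl,
          ⟨hu.1, fun a ha => hu.2 a ((hsub s' t).subset ha)⟩, hv, h.replace_last ?_⟩
        exact fun z => ih (Nat.lt_succ_iff.1 hlow)
      · refine ⟨ss ++ (s' ++ ([y] ++ t'), x) :: ts, ul, vs, vl, ?_, rfl, ⟨?_, hu.2⟩, hv,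
          h.replace_block fun z => ih (Nat.lt_succ_iff.1 hlow)⟩
        · simp [glue_append_cons, glue_append_last]
        · intro q hq
          rw [List.mem_append, List.mem_cons] at hq
          rcases hq with hq | rfl | hq
          · exact hu.1 q (by simp [hq])
          · have := hu.1 (s' ++ (y :: (w ++ [y']) ++ t'), x) (by simp)
            exact ⟨this.1, fun a ha => this.2 a ((hsub s' t').subset ha)⟩
          · exact hu.1 q (by simp [hq])
    · obtain ⟨ss, b, ts, rfl, rfl, e'⟩ := hu.split_separator hy
        (s := s) (r := w ++ y' :: t) (by rw [← e]; simp)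
      have hts : IsDecomp prio (p + 1) ts ul := ⟨fun q hq => hu.1 q (by simp [hq]), hu.2⟩
      obtain ⟨ss', b', ts, rfl, rfl, rfl⟩ := hts.split_separator (hyy'.trans hy) e'.symm
      cases ss' with
      | cons q ss' =>
        have h1 := hw q.2 (mem_glue.2 (.inl ⟨q, by simp, .inr rfl⟩))
        have h2 := (hts.1 q (by simp)).1
        omega
      | nil =>
        refine ⟨ss ++ (b, y) :: ts, ul, vs, vl, by simp [glue_append_cons], rfl,
          ⟨fun q hq => hu.1 q ?_, hu.2⟩, hv, h.contract hy hv⟩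
        simp only [List.mem_append, List.mem_cons] at hq ⊢
        tauto

theorem BlockLE.of_reduces (hp : ∀ a, prio a ≤ p) {u v : List α} (huv : Reduces prio u v)
    {s t z : List α} (h : BlockLE prio p (s ++ (v ++ t)) z) :
    BlockLE prio p (s ++ (u ++ t)) z := by
  induction huv generalizing s t with
  | refl => exact h
  | trans _ _ ih ih' => exact ih (ih' h)
  | @append u u' v v' _ _ ih ih' =>
    have h1 := ih (s := s) (t := v' ++ t) (by simpa using h)
    have h2 := ih' (s := s ++ u) (t := t) (by simpa using h1)
    simpa using h2
  | contract hyz hw => exact h.contract hyz hw (hp _)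

end BlockOrder

/-- For any language over a finite priority alphabet, the block downward
closure `L⇓ = { u | ∃ v ∈ L, u ⊴ v }` is a regular language. -/
theorem block_downward_closure_regular {α : Type*} [Fintype α]
    (prio : α → ℕ) (d : ℕ) (hd : ∀ a : α, prio a ≤ d) (L : Language α) :
    Language.IsRegular {u : List α | ∃ v ∈ L, BlockLE prio d u v} := by
  have hwqo : WellQuasiOrdered (Reduces prio) := by
    rw [← Set.partiallyWellOrderedOn_univ_iff]
    exact (partiallyWellOrderedOn_reduces prio (d + 1)).mono
      fun w _ a _ => Nat.lt_succ_of_le (hd a)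
  refine Language.isRegular_of_wellQuasiOrdered hwqo (fun _ _ _ _ => .append) _ ?_
  rintro u v huv ⟨z, hz, h⟩
  exact ⟨z, hz, by simpa using
    BlockLE.of_reduces hd huv (s := []) (t := []) (by simpa using h)⟩
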